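/- arXiv:math/0212272 — 2 statements merged into one kernel-verified Lean document; each statement's English description precedes it below -/
import Mathlib

section
/- In the graded algebra gr Y_p(gl_2), which is a polynomial algebra in the variables t̄_{ij}^{(k)} (i,j ∈ {1,2}, k = 1,...,p), the sequence t̄_{22}^{(1)}, ..., t̄_{22}^{(p)}, d̄_1, ..., d̄_{2p} is a regular sequence, where d̄_i are the graded images of the coefficients of the quantum determinant D(u) = u^{2p} + d_1 u^{2p-1} + ... + d_{2p}. -/
/-- `IsRegSeq I l` : the list `l` is a regular sequence modulo the ideal `I`:
each element is a non-unit and a non-zerodivisor modulo `I` together with the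
previous elements of the list.  `IsRegSeq ⊥ l` says that `l` is a regular sequence. -/
inductive IsRegSeq {R : Type} [CommRing R] : Ideal R → List R → Prop
  | nil (I : Ideal R) : IsRegSeq I []
  | cons (I : Ideal R) (x : R) (l : List R)
      (hu : ¬ IsUnit (Ideal.Quotient.mk I x))
      (hnzd : ∀ y : R ⧸ I, Ideal.Quotient.mk I x * y = 0 → y = 0)
      (ht : IsRegSeq (I ⊔ Ideal.span {x}) l) : IsRegSeq I (x :: l)

/-- The generator `t̄_(ij)^(r)` of the graded algebra `gr Y_p(gl_2)`, which by the PBW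
theorem is the polynomial algebra on the variables `t̄_(ij)^(k)`, `i,j ∈ (1,2)`,
`k = 1,…,p`.  Matrix indices `0,1` stand for `1,2`; the value is `0` out of range. -/
noncomputable def tbar (K : Type) [Field K] (p : ℕ) (i j : Fin 2) (r : ℕ) :
    MvPolynomial (Fin 2 × Fin 2 × Fin p) K :=
  if h : 1 ≤ r ∧ r ≤ p then MvPolynomial.X (i, j, (⟨r - 1, by omega⟩ : Fin p)) else 0

/-- The graded image `d̄_i` of the `i`-th coefficient of the quantum determinant:
`d̄_i = t̄_11^(i) + t̄_22^(i) + Σ_(j=1)^(i-1) (t̄_11^(j) t̄_22^(i-j) - t̄_21^(j) t̄_12^(i-j))`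
for `i ≤ p`, and
`d̄_i = Σ_(j=i-p)^(p) (t̄_11^(j) t̄_22^(i-j) - t̄_21^(j) t̄_12^(i-j))` for `p < i ≤ 2p`. -/
noncomputable def dbar (K : Type) [Field K] (p : ℕ) (i : ℕ) :
    MvPolynomial (Fin 2 × Fin 2 × Fin p) K :=
  (if i ≤ p then tbar K p 0 0 i + tbar K p 1 1 i else 0) +
    ∑ j ∈ Finset.Icc (max 1 (i - p)) (min (i - 1) p),
      (tbar K p 0 0 j * tbar K p 1 1 (i - j) - tbar K p 1 0 j * tbar K p 0 1 (i - j))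

/-- The list `l` is a weakly regular sequence modulo the ideal `I`: each element is a
non-zerodivisor modulo `I` together with the previous elements of the list. -/
def IsWeakRegSeq {R : Type} [CommRing R] : Ideal R → List R → Prop
  | _, [] => True
  | I, x :: l => (∀ y, x * y ∈ I → y ∈ I) ∧ IsWeakRegSeq (I ⊔ Ideal.span {x}) l

theorem Ideal.mem_sup_span_singleton_iff {R : Type*} [CommRing R] {I : Ideal R} {x r : R} :
    r ∈ I ⊔ Ideal.span {x} ↔ ∃ t, r - t * x ∈ I := by
  rw [sup_comm, Ideal.mem_span_singleton_sup]
  constructor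
  · rintro ⟨t, j, hj, rfl⟩
    exact ⟨t, by simpa using hj⟩
  · rintro ⟨t, ht⟩
    exact ⟨t, _, ht, by ring⟩

theorem Ideal.sup_span_singleton_congr {R : Type*} [CommRing R] {I : Ideal R} {x y : R}
    (h : x - y ∈ I) : I ⊔ Ideal.span {x} = I ⊔ Ideal.span {y} := by
  refine le_antisymm (sup_le le_sup_left ?_) (sup_le le_sup_left ?_) <;>
    rw [Ideal.span_singleton_le_iff_mem, Ideal.mem_sup_span_singleton_iff] <;>
    refine ⟨1, ?_⟩
  · simpa using h
  · simpa using I.neg_mem h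

namespace IsWeakRegSeq

variable {R : Type} [CommRing R]

theorem isRegSeq {m : Ideal R} (hm : m ≠ ⊤) {I : Ideal R} {l : List R} (hI : I ≤ m)
    (hl : ∀ x ∈ l, x ∈ m) (h : IsWeakRegSeq I l) : IsRegSeq I l := by
  induction l generalizing I with
  | nil => exact .nil I
  | cons x l ih =>
    have hx : I ⊔ Ideal.span {x} ≤ m :=
      sup_le hI ((Ideal.span_singleton_le_iff_mem m).2 (hl x (by simp)))
    refine .cons I x l ?_ ?_ (ih hx (fun y hy => hl y (by simp [hy])) h.2)
    · intro hu
      have hmap := Ideal.mem_map_of_mem (Ideal.Quotient.mk I) (hl x (by simp))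
      have htop := Ideal.eq_top_of_isUnit_mem _ hmap hu
      apply hm
      rw [← Ideal.comap_top (f := Ideal.Quotient.mk I), ← htop,
        Ideal.comap_map_of_surjective _ Ideal.Quotient.mk_surjective, ← RingHom.ker_eq_comap_bot,
        Ideal.mk_ker, sup_eq_left.2 hI]
    · intro y hy
      obtain ⟨y, rfl⟩ := Ideal.Quotient.mk_surjective y
      rw [← map_mul, Ideal.Quotient.eq_zero_iff_mem] at hy
      exact Ideal.Quotient.eq_zero_iff_mem.2 (h.1 y hy)

theorem append_iff {I : Ideal R} {l l' : List R} :
    IsWeakRegSeq I (l ++ l') ↔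
      IsWeakRegSeq I l ∧ IsWeakRegSeq (I ⊔ Ideal.span {x | x ∈ l}) l' := by
  induction l generalizing I with
  | nil => simp [IsWeakRegSeq]
  | cons x l ih =>
    have hs : {y | y ∈ x :: l} = {x} ∪ {y | y ∈ l} := by ext; simp
    simp only [List.cons_append, IsWeakRegSeq, ih, hs, Ideal.span_union, sup_assoc, and_assoc]

theorem congr {I : Ideal R} {l l' : List R} (hl : List.Forall₂ (fun x y => x - y ∈ I) l l')
    (h : IsWeakRegSeq I l) : IsWeakRegSeq I l' := by
  induction l generalizing I l' with
  | nil => simp_all [IsWeakRegSeq]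
  | cons x l ih =>
    obtain ⟨y, l', hxy, hl', rfl⟩ := List.forall₂_cons_left_iff.1 hl
    refine ⟨fun r hr => h.1 r ?_, ?_⟩
    · have : x * r = (x - y) * r + y * r := by ring
      rw [this]
      exact I.add_mem (I.mul_mem_right r hxy) hr
    · rw [← Ideal.sup_span_singleton_congr hxy]
      exact ih (hl'.imp fun _ _ h => (le_sup_left : I ≤ I ⊔ _) h) h.2

theorem map_equiv {S : Type} [CommRing S] (e : R ≃+* S) {I : Ideal R} {l : List R}
    (h : IsWeakRegSeq I l) : IsWeakRegSeq (I.map e) (l.map e) := by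
  induction l generalizing I with
  | nil => trivial
  | cons x l ih =>
    refine ⟨fun y hy => ?_, ?_⟩
    · obtain ⟨z, hz, hzy⟩ := (Ideal.mem_map_of_equiv e _).1 hy
      obtain ⟨y, rfl⟩ := e.surjective y
      rw [← map_mul, e.injective.eq_iff] at hzy
      exact Ideal.mem_map_of_mem e (h.1 y (hzy ▸ hz))
    · have := ih h.2
      rwa [Ideal.map_sup, Ideal.map_span, Set.image_singleton] at this

/-- Weak regularity passes from the outer terms to the middle term of the exact sequence
`0 → R ⧸ (J : x) → R ⧸ J → R ⧸ (J ⊔ (x)) → 0`. -/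
theorem of_exact {x : R} {J J' J'' : Ideal R} {l : List R} (h' : ∀ r, r ∈ J' ↔ x * r ∈ J)
    (h'' : J'' = J ⊔ Ideal.span {x}) (hl' : IsWeakRegSeq J' l) (hl'' : IsWeakRegSeq J'' l) :
    IsWeakRegSeq J l := by
  induction l generalizing J J' J'' with
  | nil => trivial
  | cons f l ih =>
    have key : ∀ s, f * s ∈ J → ∃ t, s - t * x ∈ J ∧ t ∈ J' := fun s hs => by
      have := hl''.1 s (h'' ▸ (le_sup_left : J ≤ J ⊔ _) hs)
      rw [h'', Ideal.mem_sup_span_singleton_iff] at this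
      obtain ⟨t, ht⟩ := this
      refine ⟨t, ht, hl'.1 t ((h' _).2 ?_)⟩
      have : x * (f * t) = f * s - f * (s - t * x) := by ring
      rw [this]
      exact J.sub_mem hs (J.mul_mem_left f ht)
    refine ⟨fun y hy => ?_, ih (J' := J' ⊔ Ideal.span {f}) (J'' := J'' ⊔ Ideal.span {f}) ?_ ?_
      hl'.2 hl''.2⟩
    · obtain ⟨t, ht, ht'⟩ := key y hy
      have : y = (y - t * x) + x * t := by ring
      rw [this]
      exact J.add_mem ht ((h' t).1 ht')
    · intro r
      rw [Ideal.mem_sup_span_singleton_iff, Ideal.mem_sup_span_singleton_iff]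
      constructor
      · rintro ⟨t, ht⟩
        refine ⟨x * t, ?_⟩
        convert (h' _).1 ht using 1
        ring
      · rintro ⟨s, hs⟩
        have hfs : f * s ∈ J'' := by
          rw [h'', Ideal.mem_sup_span_singleton_iff]
          refine ⟨r, ?_⟩
          convert J.neg_mem hs using 1
          ring
        have := hl''.1 s hfs
        rw [h'', Ideal.mem_sup_span_singleton_iff] at this
        obtain ⟨t, ht⟩ := this
        refine ⟨t, (h' _).2 ?_⟩
        have : x * (r - t * f) = (x * r - s * f) + f * (s - t * x) := by ring
        rw [this]
        exact J.add_mem hs (J.mul_mem_left f ht)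
    · rw [h'', sup_assoc, sup_assoc, sup_comm (Ideal.span {x})]

/-- A product of two non-zerodivisors modulo `I` may stand at the head of a weakly regular
sequence as soon as each of its factors may. -/
theorem mul_cons {I : Ideal R} {x y : R} {l : List R} (hx : IsWeakRegSeq I (x :: l))
    (hy : IsWeakRegSeq I (y :: l)) : IsWeakRegSeq I (x * y :: l) := by
  refine ⟨fun r hr => hy.1 r (hx.1 _ (by rwa [← mul_assoc])),
    of_exact (x := x) (fun r => ?_) ?_ hy.2 hx.2⟩
  · rw [Ideal.mem_sup_span_singleton_iff, Ideal.mem_sup_span_singleton_iff]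
    have h : ∀ t, x * r - t * (x * y) = x * (r - t * y) := fun t => by ring
    simp only [h]
    exact exists_congr fun t => ⟨I.mul_mem_left x, hx.1 _⟩
  · rw [sup_assoc]
    congr 1
    refine (sup_eq_right.2 ?_).symm
    exact Ideal.span_singleton_le_span_singleton.2 (dvd_mul_right x y)

/-- If every shuffle of `b 0, …, b (s - 1)` and `c 0, …, c (t - 1)` with `s + t = n`, followed by
`l`, is weakly regular, then so is the sequence of the first `n` coefficients of the product of the
power series with coefficients `b` and `c`, followed by `l`. -/
theorem map_sum_antidiagonal_append {I : Ideal R} {l : List R} (n : ℕ) (b c : ℕ → R)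
    (h : ∀ s t l', s + t = n → l'.Perm ((List.range s).map b ++ (List.range t).map c) →
      IsWeakRegSeq I (l' ++ l)) :
    IsWeakRegSeq I
      ((List.range n).map (fun k => ∑ q ∈ Finset.HasAntidiagonal.antidiagonal k, b q.1 * c q.2) ++ l) := by
  induction n generalizing I b c with
  | zero => exact h 0 0 [] rfl (by simp)
  | succ n ih =>
    rw [List.range_succ_eq_map, List.map_cons, List.map_map, List.cons_append,
      Finset.Nat.antidiagonal_zero, Finset.sum_singleton]
    have hb : ∀ s t l', s + t = n →
        l'.Perm ((List.range s).map (fun i => b (i + 1)) ++ (List.range t).map c) →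
        IsWeakRegSeq I (b 0 :: (l' ++ l)) := fun s t l' hst hl' => by
      refine h (s + 1) t (b 0 :: l') (by omega) ?_
      rw [List.range_succ_eq_map, List.map_cons, List.map_map, List.cons_append]
      exact hl'.cons _
    have hc : ∀ s t l', s + t = n →
        l'.Perm ((List.range s).map b ++ (List.range t).map (fun i => c (i + 1))) →
        IsWeakRegSeq I (c 0 :: (l' ++ l)) := fun s t l' hst hl' => by
      refine h s (t + 1) (c 0 :: l') (by omega) ?_
      rw [List.range_succ_eq_map, List.map_cons, List.map_map]
      exact (hl'.cons _).trans List.perm_middle.symm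
    have congr_append : ∀ {J : Ideal R} {f g : ℕ → R}, (∀ k, f k - g k ∈ J) →
        IsWeakRegSeq J ((List.range n).map f ++ l) →
        IsWeakRegSeq J ((List.range n).map g ++ l) := fun hfg h => by
      refine h.congr (List.rel_append ?_ (List.forall₂_same.2 (by simp)))
      rw [List.forall₂_map_left_iff, List.forall₂_map_right_iff]
      exact List.forall₂_same.2 fun k _ => hfg k
    refine mul_cons ⟨(hb n 0 _ rfl (.refl _)).1, ?_⟩ ⟨(hc n 0 _ rfl (.refl _)).1, ?_⟩
    · refine congr_append (fun k => ?_) (ih _ _ fun s t l' hst hl' => (hb s t l' hst hl').2)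
      simp only [Function.comp_apply, Nat.succ_eq_add_one, Finset.Nat.antidiagonal_succ,
        Finset.sum_cons, Finset.sum_map]
      refine Ideal.mem_sup_span_singleton_iff.2 ⟨-c (k + 1), ?_⟩
      simp [Prod.map, mul_comm]
    · refine congr_append (fun k => ?_) (ih _ _ fun s t l' hst hl' => (hc s t l' hst hl').2)
      simp only [Function.comp_apply, Nat.succ_eq_add_one, Finset.Nat.antidiagonal_succ',
        Finset.sum_cons, Finset.sum_map]
      refine Ideal.mem_sup_span_singleton_iff.2 ⟨-b (k + 1), ?_⟩
      simp [Prod.map]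

section Graded

variable {σ : Type} [SetLike σ R] [AddSubgroupClass σ R] (𝒜 : ℕ → σ) [GradedRing 𝒜]

theorem mem_of_forall_mem_sup_span_pow {I : Ideal R} (hI : I.IsHomogeneous 𝒜) {x r : R} {d : ℕ}
    (hd : 0 < d) (hx : x ∈ 𝒜 d) (h : ∀ n, r ∈ I ⊔ Ideal.span {x ^ n}) : r ∈ I := by
  classical
  refine (hI.mem_iff).2 fun i => ?_
  obtain ⟨t, ht⟩ := Ideal.mem_sup_span_singleton_iff.1 (h (i + 1))
  have hz : (DirectSum.decompose 𝒜 (t * x ^ (i + 1)) i : R) = 0 :=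
    DirectSum.coe_decompose_mul_of_right_mem_of_not_le 𝒜 (SetLike.pow_mem_graded (i + 1) hx)
      (by simp only [smul_eq_mul]; nlinarith)
  have := (hI.mem_iff).1 ht i
  rwa [DirectSum.decompose_sub, DirectSum.sub_apply, AddSubgroupClass.coe_sub, hz, sub_zero] at this

theorem swap {I : Ideal R} (hI : I.IsHomogeneous 𝒜) {x y : R} {l : List R} {d : ℕ}
    (hd : 0 < d) (hx : x ∈ 𝒜 d) (h : IsWeakRegSeq I (x :: y :: l)) :
    IsWeakRegSeq I (y :: x :: l) := by
  obtain ⟨h₁, h₂, h₃⟩ := h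
  refine ⟨fun r hr => ?_, fun r hr => ?_, by rwa [sup_right_comm]⟩
  · refine mem_of_forall_mem_sup_span_pow 𝒜 hI hd hx fun n => ?_
    suffices ∃ t, r - t * x ^ n ∈ I ∧ y * t ∈ I from
      Ideal.mem_sup_span_singleton_iff.2 ⟨this.choose, this.choose_spec.1⟩
    induction n with
    | zero => exact ⟨r, by simp, hr⟩
    | succ n ih =>
      obtain ⟨t, ht, hyt⟩ := ih
      obtain ⟨s, hs⟩ := Ideal.mem_sup_span_singleton_iff.1
        (h₂ t ((le_sup_left : I ≤ I ⊔ _) hyt))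
      refine ⟨s, ?_, h₁ _ ?_⟩
      · have : r - s * x ^ (n + 1) = (r - t * x ^ n) + (t - s * x) * x ^ n := by ring
        rw [this]
        exact I.add_mem ht (I.mul_mem_right _ hs)
      · have : x * (y * s) = y * t - y * (t - s * x) := by ring
        rw [this]
        exact I.sub_mem hyt (I.mul_mem_left _ hs)
  · obtain ⟨s, hs⟩ := Ideal.mem_sup_span_singleton_iff.1 hr
    have : s ∈ I ⊔ Ideal.span {x} := by
      refine h₂ s (Ideal.mem_sup_span_singleton_iff.2 ⟨r, ?_⟩)
      convert I.neg_mem hs using 1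
      ring
    obtain ⟨t, ht⟩ := Ideal.mem_sup_span_singleton_iff.1 this
    refine Ideal.mem_sup_span_singleton_iff.2 ⟨t, h₁ _ ?_⟩
    have : x * (r - t * y) = (x * r - s * y) + y * (s - t * x) := by ring
    rw [this]
    exact I.add_mem hs (I.mul_mem_left _ ht)

theorem perm {I : Ideal R} (hI : I.IsHomogeneous 𝒜) {l l' : List R} (hll' : l.Perm l')
    (hl : ∀ x ∈ l, ∃ d, 0 < d ∧ x ∈ 𝒜 d) (h : IsWeakRegSeq I l) : IsWeakRegSeq I l' := by
  induction hll' generalizing I with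
  | nil => trivial
  | cons x _ ih =>
    obtain ⟨d, -, hx⟩ := hl x (by simp)
    refine ⟨h.1, ih ?_ (fun y hy => hl y (by simp [hy])) h.2⟩
    exact hI.sup (Ideal.homogeneous_span 𝒜 _ fun y hy => ⟨d, Set.mem_singleton_iff.1 hy ▸ hx⟩)
  | swap x y l =>
    obtain ⟨d, hd, hy⟩ := hl y (by simp)
    exact swap 𝒜 hI hd hy h
  | trans h₁ _ ih₁ ih₂ =>
    exact ih₂ hI (fun x hx => hl x (h₁.mem_iff.2 hx)) (ih₁ hI hl h)

end Graded

theorem map_X {σ : Type} {A : Type} [CommRing A] {l : List σ} (s : Set σ) (hl : l.Nodup)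
    (hs : ∀ i ∈ l, i ∉ s) :
    IsWeakRegSeq (Ideal.span (MvPolynomial.X '' s : Set (MvPolynomial σ A)))
      (l.map MvPolynomial.X) := by
  induction l generalizing s with
  | nil => trivial
  | cons v l ih =>
    rw [List.nodup_cons] at hl
    refine ⟨fun y hy => ?_, ?_⟩
    · rw [MvPolynomial.mem_ideal_span_X_image] at hy ⊢
      intro m hm
      obtain ⟨i, hi, hmi⟩ := hy (Finsupp.single v 1 + m) (by simpa using hm)
      refine ⟨i, hi, ?_⟩
      have hvi : v ≠ i := fun h => hs v (by simp) (h ▸ hi)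
      simpa [Finsupp.single_apply, hvi] using hmi
    · rw [← Ideal.span_union, ← Set.image_singleton, ← Set.image_union]
      refine ih _ hl.2 fun i hi => ?_
      rintro (his | rfl)
      · exact hs i (by simp [hi]) his
      · exact hl.1 hi

end IsWeakRegSeq

/-- A surjective endomorphism of a Noetherian ring is injective. -/
theorem RingHom.injective_of_surjective_of_isNoetherianRing {R : Type*} [CommRing R]
    [IsNoetherianRing R] (f : R →+* R) (hf : Function.Surjective f) : Function.Injective f := by
  have hmono : Monotone fun n => RingHom.ker (f ^ n) := monotone_nat_of_le_succ fun n x hx => by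
    rw [RingHom.mem_ker] at hx ⊢
    rw [pow_succ', RingHom.mul_def, RingHom.comp_apply, hx, map_zero]
  obtain ⟨n, hn⟩ := monotone_stabilizes_iff_noetherian.2 ‹IsNoetherianRing R› ⟨_, hmono⟩
  refine (injective_iff_map_eq_zero f).2 fun x hx => ?_
  have hsurj : Function.Surjective (f ^ n) := by
    rw [RingHom.coe_pow]
    exact hf.iterate n
  obtain ⟨y, rfl⟩ := hsurj x
  have hy : y ∈ RingHom.ker (f ^ (n + 1)) := by
    rwa [RingHom.mem_ker, pow_succ', RingHom.mul_def, RingHom.comp_apply]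
  have := hn (n + 1) n.le_succ
  simp only [OrderHom.coe_mk] at this
  rwa [← this] at hy

/-- A weakly regular sequence of weighted homogeneous polynomials of positive weight may be
permuted. -/
theorem IsWeakRegSeq.perm_of_isWeightedHomogeneous {σ A : Type} [CommRing A] (w : σ → ℕ)
    {l l' : List (MvPolynomial σ A)} (hll' : l.Perm l')
    (hl : ∀ x ∈ l, ∃ d, 0 < d ∧ MvPolynomial.IsWeightedHomogeneous w x d)
    (h : IsWeakRegSeq ⊥ l) : IsWeakRegSeq ⊥ l' :=
  letI := MvPolynomial.weightedGradedAlgebra A w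
  h.perm (MvPolynomial.weightedHomogeneousSubmodule A w) (Ideal.IsHomogeneous.bot _) hll' hl

section QuantumDeterminant

open MvPolynomial

variable {K : Type} [Field K] {p : ℕ}

theorem tbar_val_add_one (i j : Fin 2) (k : Fin p) :
    tbar K p i j ((k : ℕ) + 1) = X (i, j, k) := by
  simp [tbar]

theorem tbar_sub {n : ℕ} (i j : Fin 2) (hn : n < p) :
    tbar K p i j (p - n) = X (i, j, ⟨p - 1 - n, by omega⟩) := by
  rw [← tbar_val_add_one]
  congr 1
  simp only
  omega

theorem constantCoeff_tbar (i j : Fin 2) (r : ℕ) : constantCoeff (tbar K p i j r) = 0 := by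
  unfold tbar
  split_ifs <;> simp

theorem constantCoeff_dbar (i : ℕ) : constantCoeff (dbar K p i) = 0 := by
  unfold dbar
  split_ifs <;> simp [constantCoeff_tbar]

/-- The weight of the variable `t̄_(ij)^(k)` is `k`. -/
def tbarWeight (p : ℕ) (v : Fin 2 × Fin 2 × Fin p) : ℕ := v.2.2 + 1

theorem isWeightedHomogeneous_tbar (i j : Fin 2) (r : ℕ) :
    IsWeightedHomogeneous (tbarWeight p) (tbar K p i j r) r := by
  unfold tbar
  split_ifs with h
  · have := isWeightedHomogeneous_X K (tbarWeight p) (i, j, (⟨r - 1, by omega⟩ : Fin p))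
    rwa [show tbarWeight p (i, j, (⟨r - 1, by omega⟩ : Fin p)) = r from Nat.sub_add_cancel h.1]
      at this
  · exact isWeightedHomogeneous_zero K _ _

theorem isWeightedHomogeneous_dbar (i : ℕ) :
    IsWeightedHomogeneous (tbarWeight p) (dbar K p i) i := by
  unfold dbar
  refine .add ?_ (.sum _ _ _ fun j hj => ?_)
  · split_ifs
    · exact (isWeightedHomogeneous_tbar _ _ _).add (isWeightedHomogeneous_tbar _ _ _)
    · exact isWeightedHomogeneous_zero K _ _
  · have hji : j + (i - j) = i := by
      rw [Finset.mem_Icc] at hj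
      omega
    have := fun a b c d : Fin 2 => (isWeightedHomogeneous_tbar (K := K) (p := p) a b j).mul
      (isWeightedHomogeneous_tbar c d (i - j))
    rw [hji] at this
    exact (this _ _ _ _).sub (this _ _ _ _)

/-- The endomorphism which sends `t̄_11^(k)` to `d̄_k`, changes the sign of `t̄_12^(k)` and
fixes the other variables. -/
noncomputable def dbarHom (K : Type) [Field K] (p : ℕ) :
    MvPolynomial (Fin 2 × Fin 2 × Fin p) K →ₐ[K] MvPolynomial (Fin 2 × Fin 2 × Fin p) K :=
  aeval fun v => if v.1 = 1 then X v else if v.2.1 = 1 then -X v else dbar K p (v.2.2 + 1)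

@[simp] theorem dbarHom_X_one (j : Fin 2) (k : Fin p) :
    dbarHom K p (X (1, j, k)) = X (1, j, k) := by
  simp [dbarHom]

@[simp] theorem dbarHom_X_zero_one (k : Fin p) :
    dbarHom K p (X (0, 1, k)) = -X (0, 1, k) := by
  simp [dbarHom]

@[simp] theorem dbarHom_X_zero_zero (k : Fin p) :
    dbarHom K p (X (0, 0, k)) = dbar K p (k + 1) := by
  simp [dbarHom]

theorem dbarHom_surjective : Function.Surjective (dbarHom K p) := by
  rw [← AlgHom.range_eq_top]
  set S := (dbarHom K p).range
  have h1 : ∀ j k, X (1, j, k) ∈ S := fun j k => ⟨X (1, j, k), by simp⟩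
  have h01 : ∀ k, X (0, 1, k) ∈ S := fun k => ⟨-X (0, 1, k), by simp⟩
  have h00 : ∀ k, dbar K p ((k : Fin p) + 1) ∈ S := fun k => ⟨X (0, 0, k), by simp⟩
  have ht : ∀ i j, ¬(i = 0 ∧ j = 0) → ∀ r, tbar K p i j r ∈ S := by
    intro i j hij r
    unfold tbar
    split_ifs
    · fin_cases i
      · fin_cases j
        · simp at hij
        · exact h01 _
      · exact h1 _ _
    · exact S.zero_mem
  have ha : ∀ r, tbar K p 0 0 r ∈ S := by
    intro r
    induction r using Nat.strong_induction_on with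
    | _ r ih =>
      by_cases hr : 1 ≤ r ∧ r ≤ p
      · have hd := h00 ⟨r - 1, by omega⟩
        simp only [Nat.sub_add_cancel hr.1] at hd
        rw [dbar, if_pos hr.2, add_assoc] at hd
        refine (add_mem_cancel_right (add_mem (ht 1 1 (by simp) r) (sum_mem fun j hj => ?_))).1 hd
        rw [Finset.mem_Icc] at hj
        exact sub_mem (mul_mem (ih j (by omega)) (ht _ _ (by simp) _))
          (mul_mem (ht _ _ (by simp) _) (ht _ _ (by simp) _))
      · rw [tbar, dif_neg hr]
        exact S.zero_mem
  rw [eq_top_iff, ← adjoin_range_X, Algebra.adjoin_le_iff]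
  rintro _ ⟨⟨i, j, k⟩, rfl⟩
  fin_cases i
  · fin_cases j
    · have := ha (k + 1)
      rwa [tbar_val_add_one] at this
    · exact h01 _
  · exact h1 _ _

theorem dbarHom_bijective : Function.Bijective (dbarHom K p) :=
  ⟨(dbarHom K p).toRingHom.injective_of_surjective_of_isNoetherianRing dbarHom_surjective,
    dbarHom_surjective⟩

/-- Modulo the `t̄_22^(k)`, the elements `d̄_(2p), …, d̄_(p+1)` are the first coefficients of a
product of two polynomials. -/
theorem dbar_sub_mem {n : ℕ} (hn : n < p) :
    dbar K p (2 * p - n) - ∑ q ∈ Finset.HasAntidiagonal.antidiagonal n,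
      -tbar K p 0 1 (p - q.1) * tbar K p 1 0 (p - q.2) ∈
      Ideal.span {x | x ∈ List.ofFn fun k : Fin p => tbar K p 1 1 ((k : ℕ) + 1)} := by
  set J := Ideal.span {x | x ∈ List.ofFn fun k : Fin p => tbar K p 1 1 ((k : ℕ) + 1)}
  have hJ : ∀ r, tbar K p 1 1 r ∈ J := fun r => by
    by_cases hr : 1 ≤ r ∧ r ≤ p
    · refine Ideal.subset_span (List.mem_ofFn.2 ⟨⟨r - 1, by omega⟩, ?_⟩)
      simp only [Nat.sub_add_cancel hr.1]
    · rw [tbar, dif_neg hr]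
      exact J.zero_mem
  have hsum : ∑ q ∈ Finset.HasAntidiagonal.antidiagonal n,
      -tbar K p 0 1 (p - q.1) * tbar K p 1 0 (p - q.2) =
      -∑ j ∈ Finset.Icc (max 1 (2 * p - n - p)) (min (2 * p - n - 1) p),
        tbar K p 1 0 j * tbar K p 0 1 (2 * p - n - j) := by
    rw [← Finset.sum_neg_distrib]
    refine Finset.sum_nbij' (fun q => p - q.2) (fun j => (n - (p - j), p - j)) ?_ ?_ ?_ ?_ ?_
    · rintro ⟨a, b⟩ h
      simp only [Finset.HasAntidiagonal.mem_antidiagonal, Finset.mem_Icc] at h ⊢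
      omega
    · intro j h
      simp only [Finset.HasAntidiagonal.mem_antidiagonal, Finset.mem_Icc] at h ⊢
      omega
    · rintro ⟨a, b⟩ h
      simp only [Finset.HasAntidiagonal.mem_antidiagonal, Prod.mk.injEq] at h ⊢
      omega
    · intro j h
      simp only [Finset.mem_Icc] at h ⊢
      omega
    · rintro ⟨a, b⟩ h
      simp only [Finset.HasAntidiagonal.mem_antidiagonal] at h ⊢
      rw [show 2 * p - n - (p - b) = p - a by omega]
      ring
  rw [hsum, dbar, if_neg (by omega), zero_add, Finset.sum_sub_distrib, sub_neg_eq_add,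
    sub_add_cancel]
  exact sum_mem fun j _ => J.mul_mem_left _ (hJ _)

theorem List.ofFn_val_eq_map_range {α : Type*} (n : ℕ) (f : ℕ → α) :
    (List.ofFn fun k : Fin n => f k) = (List.range n).map f :=
  List.ext_getElem (by simp) (by simp)

theorem isWeakRegSeq_tbar_dbar {s t : ℕ} (hs : s ≤ p) (ht : t ≤ p) :
    IsWeakRegSeq ⊥ ((List.ofFn fun k : Fin p => tbar K p 1 1 ((k : ℕ) + 1)) ++
      (((List.range s).map (fun n => -tbar K p 0 1 (p - n)) ++
        (List.range t).map (fun n => tbar K p 1 0 (p - n))) ++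
        (List.range p).map fun n => dbar K p (n + 1))) := by
  let e := RingEquiv.ofBijective (dbarHom K p) dbarHom_bijective
  let l : List (Fin 2 × Fin 2 × Fin p) := (List.ofFn fun k : Fin p => (1, 1, k)) ++
    (((List.ofFn fun n : Fin s => (0, 1, ⟨p - 1 - n, by omega⟩)) ++
      (List.ofFn fun n : Fin t => (1, 0, ⟨p - 1 - n, by omega⟩))) ++
      List.ofFn fun k : Fin p => (0, 0, k))
  have hl : l.Nodup := by
    simp only [l, List.nodup_append, List.nodup_ofFn, Function.Injective, List.mem_append,
      List.mem_ofFn, Prod.mk.injEq, Fin.ext_iff]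
    refine ⟨fun _ _ h => h.2.2, ⟨⟨fun i j h => by omega, fun i j h => by omega, ?_⟩,
      fun _ _ h => h.2.2, ?_⟩, ?_⟩
    · rintro _ ⟨i, rfl⟩ _ ⟨j, rfl⟩
      simp
    · rintro _ (⟨i, rfl⟩ | ⟨i, rfl⟩) _ ⟨j, rfl⟩ <;> simp
    · rintro _ ⟨i, rfl⟩ _ ((⟨j, rfl⟩ | ⟨j, rfl⟩) | ⟨j, rfl⟩) <;> simp
  have := (IsWeakRegSeq.map_X (A := K) ∅ hl (by simp)).map_equiv e
  have he : ∀ x, e x = dbarHom K p x := fun _ => rfl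
  convert this using 1
  · simp
  · simp only [l, List.map_append, List.map_ofFn, ← List.ofFn_val_eq_map_range]
    congr 3
    · ext1 k
      simp [he, tbar_val_add_one]
    · congr 1
      ext1 k
      simp [he, tbar_sub _ _ (k.2.trans_le hs)]
    · congr 1
      ext1 k
      simp [he, tbar_sub _ _ (k.2.trans_le ht)]
    · ext1 k
      simp [he]

end QuantumDeterminant

/-- The sequence `t̄_22^(1), …, t̄_22^(p), d̄_1, …, d̄_(2p)` is a regular sequence in the
polynomial algebra `gr Y_p(gl_2)`. -/
theorem tbar_dbar_regular {K : Type} [Field K] (p : ℕ) :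
    IsRegSeq ⊥
      ((List.ofFn fun k : Fin p => tbar K p 1 1 ((k : ℕ) + 1)) ++
        (List.ofFn fun i : Fin (2 * p) => dbar K p ((i : ℕ) + 1))) := by
  have ht : ∀ (i j : Fin 2) (r : ℕ), 0 < r → ∃ d, 0 < d ∧
      MvPolynomial.IsWeightedHomogeneous (tbarWeight p) (tbar K p i j r) d :=
    fun i j r hr => ⟨r, hr, isWeightedHomogeneous_tbar i j r⟩
  have hd : ∀ r : ℕ, 0 < r → ∃ d, 0 < d ∧
      MvPolynomial.IsWeightedHomogeneous (tbarWeight p) (dbar K p r) d :=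
    fun r hr => ⟨r, hr, isWeightedHomogeneous_dbar r⟩
  have hS : IsWeakRegSeq ⊥
      ((List.ofFn fun k : Fin p => tbar K p 1 1 ((k : ℕ) + 1)) ++
        ((List.range p).map (fun n => dbar K p (2 * p - n)) ++
          (List.range p).map (fun n => dbar K p (n + 1)))) := by
    refine IsWeakRegSeq.append_iff.2 ⟨(IsWeakRegSeq.append_iff.1
      (isWeakRegSeq_tbar_dbar (s := 0) (t := 0) (by omega) (by omega))).1, ?_⟩
    rw [bot_sup_eq]
    refine IsWeakRegSeq.congr (l := (List.range p).map (fun n =>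
      ∑ q ∈ Finset.HasAntidiagonal.antidiagonal n,
        -tbar K p 0 1 (p - q.1) * tbar K p 1 0 (p - q.2)) ++ _)
      (List.rel_append ?_ (List.forall₂_same.2 (by simp))) ?_
    · rw [List.forall₂_map_left_iff, List.forall₂_map_right_iff]
      refine List.forall₂_same.2 fun n hn => ?_
      rw [← neg_mem_iff, neg_sub]
      exact dbar_sub_mem (List.mem_range.1 hn)
    · refine IsWeakRegSeq.map_sum_antidiagonal_append p (fun n => -tbar K p 0 1 (p - n))
        (fun n => tbar K p 1 0 (p - n)) fun s t l hst hl => ?_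
      rw [← bot_sup_eq (Ideal.span _)]
      refine (IsWeakRegSeq.append_iff.1 (IsWeakRegSeq.perm_of_isWeightedHomogeneous (tbarWeight p)
        ((hl.symm.append_right _).append_left _) ?_
        (isWeakRegSeq_tbar_dbar (s := s) (t := t) (by omega) (by omega)))).2
      simp only [List.mem_append, List.mem_ofFn, List.mem_map, List.mem_range]
      rintro _ (⟨k, rfl⟩ | (⟨n, hn, rfl⟩ | ⟨n, hn, rfl⟩) | ⟨n, hn, rfl⟩)
      · exact ht _ _ _ (by omega)
      · exact ⟨p - n, by omega, (isWeightedHomogeneous_tbar _ _ _).neg⟩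
      · exact ht _ _ _ (by omega)
      · exact hd _ (by omega)
  refine IsWeakRegSeq.isRegSeq (m := RingHom.ker (MvPolynomial.constantCoeff (R := K)))
    (RingHom.ker_ne_top _) bot_le ?_ (IsWeakRegSeq.perm_of_isWeightedHomogeneous (tbarWeight p)
      (.append_left _ ?_) ?_ hS)
  · simp only [List.mem_append, List.mem_ofFn]
    rintro _ (⟨k, rfl⟩ | ⟨k, rfl⟩)
    · exact constantCoeff_tbar _ _ _
    · exact constantCoeff_dbar _
  · rw [List.ofFn_val_eq_map_range (2 * p) fun n => dbar K p (n + 1), two_mul, List.range_add,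
      List.map_append]
    refine List.perm_append_comm.trans (.append_left _ ?_)
    refine (List.reverse_perm _).symm.trans (.of_eq (List.ext_getElem (by simp) fun i h _ => ?_))
    have hi : i < p := by simpa using h
    simp only [List.getElem_reverse, List.getElem_map, List.getElem_range, List.length_map,
      List.length_range]
    congr 1
    omega
  · simp only [List.mem_append, List.mem_ofFn, List.mem_map, List.mem_range]
    rintro _ (⟨k, rfl⟩ | ⟨n, hn, rfl⟩ | ⟨n, hn, rfl⟩)
    · exact ht _ _ _ (by omega)
    · exact hd _ (by omega)
    · exact hd _ (by omega)
end

section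
/- The 3p elements t_{22}^{(1)}, ..., t_{22}^{(p)}, d_1, ..., d_{2p} of the level-p Yangian Y_p(gl_2) are algebraically independent over k, where d_i are the coefficients of the quantum determinant. -/
open Polynomial

/-- Generator index for the level-`p` Yangian: `(i, j, k)` with `k : Fin p` encoding
the superscript `k+1`. -/
abbrev YGen (p : ℕ) := Fin 2 × Fin 2 × Fin p

/-- The free-algebra version of the generator `t_{ij}^{(r)}`, with the conventions
`t_{ij}^{(0)} = δ_{ij}` and `t_{ij}^{(r)} = 0` for `r > p`. -/
noncomputable def tF (K : Type) [Field K] (p : ℕ) (i j : Fin 2) (r : ℕ) :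
    FreeAlgebra K (YGen p) :=
  if h0 : r = 0 then (if i = j then 1 else 0)
  else if h : r ≤ p then FreeAlgebra.ι K (i, j, (⟨r - 1, by omega⟩ : Fin p)) else 0

/-- The defining relations of the level-`p` Yangian:
`[t_{ij}^{(r)}, t_{kl}^{(s)}] = Σ_{a=1}^{min(r,s)} (t_{kj}^{(a-1)} t_{il}^{(r+s-a)} -
t_{kj}^{(r+s-a)} t_{il}^{(a-1)})`. -/
inductive YRel (K : Type) [Field K] (p : ℕ) :
    FreeAlgebra K (YGen p) → FreeAlgebra K (YGen p) → Prop
  | rel (i j k l : Fin 2) (r s : ℕ) (hr : 1 ≤ r) (hr' : r ≤ p) (hs : 1 ≤ s) (hs' : s ≤ p) :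
      YRel K p (tF K p i j r * tF K p k l s - tF K p k l s * tF K p i j r)
        (∑ a ∈ Finset.Icc 1 (min r s),
          (tF K p k j (a - 1) * tF K p i l (r + s - a)
            - tF K p k j (r + s - a) * tF K p i l (a - 1)))

/-- The level-`p` Yangian `Y_p(gl_2)`. -/
abbrev Yp (K : Type) [Field K] (p : ℕ) := RingQuot (YRel K p)

/-- The generator `t_{ij}^{(r)}` of `Y_p(gl_2)` (matrix indices `0,1` stand for `1,2`). -/
noncomputable def tY (K : Type) [Field K] (p : ℕ) (i j : Fin 2) (r : ℕ) : Yp K p :=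
  RingQuot.mkAlgHom K (YRel K p) (tF K p i j r)

/-- The generating polynomial `T_{ij}(u) = δ_{ij} u^p + Σ_{k=1}^p t_{ij}^{(k)} u^{p-k}`. -/
noncomputable def TY (K : Type) [Field K] (p : ℕ) (i j : Fin 2) : Polynomial (Yp K p) :=
  (if i = j then X ^ p else 0) + ∑ k ∈ Finset.Icc 1 p, C (tY K p i j k) * X ^ (p - k)

/-- The quantum determinant `D(u) = T_{11}(u) T_{22}(u-1) - T_{21}(u) T_{12}(u-1)`. -/
noncomputable def DY (K : Type) [Field K] (p : ℕ) : Polynomial (Yp K p) :=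
  TY K p 0 0 * (TY K p 1 1).comp (X - 1) - TY K p 1 0 * (TY K p 0 1).comp (X - 1)

/-- The coefficient `d_i` of the quantum determinant: `D(u) = u^{2p} + Σ_i d_i u^{2p-i}`. -/
noncomputable def dY (K : Type) [Field K] (p : ℕ) (i : ℕ) : Yp K p :=
  (DY K p).coeff (2 * p - i)

/-- The commutative subalgebra `Γ` generated by `t_{22}^{(1)},…,t_{22}^{(p)}` and
`d_1,…,d_{2p}`. -/
noncomputable def Gam (K : Type) [Field K] (p : ℕ) : Subalgebra K (Yp K p) :=
  Algebra.adjoin K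
    ({x | ∃ k ∈ Finset.Icc 1 p, x = tY K p 1 1 k} ∪
     {x | ∃ i ∈ Finset.Icc 1 (2 * p), x = dY K p i})

/-- The family of the `3p` elements `t_22^(1),…,t_22^(p), d_1,…,d_(2p)` of `Y_p(gl_2)`. -/
noncomputable def gamGen (K : Type) [Field K] (p : ℕ) (i : Fin (3 * p)) : Yp K p :=
  if h : (i : ℕ) < p then tY K p 1 1 ((i : ℕ) + 1) else dY K p ((i : ℕ) - p + 1)

/-- Evaluation of a (commutative) polynomial at the family `gamGen`, monomial by
monomial (the elements pairwise commute, so the order of the product is irrelevant). -/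
noncomputable def gamEval (K : Type) [Field K] (p : ℕ)
    (P : MvPolynomial (Fin (3 * p)) K) : Yp K p :=
  ∑ m ∈ P.support,
    algebraMap K (Yp K p) (MvPolynomial.coeff m P) *
      ((List.finRange (3 * p)).map (fun i => gamGen K p i ^ m i)).prod

/-- The component form of the `RTT` relation for two matrices, `z` being the difference of the
spectral parameters. -/
def RTT {B : Type*} [Ring B] (z : B) (S T : Matrix (Fin 2) (Fin 2) B) : Prop :=
  ∀ i j k l, z * (S i j * T k l - T k l * S i j) = S k j * T i l - T k j * S i l

/-- The quantum determinant of a pair of matrices. -/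
def qdet {B : Type*} [Ring B] (S T : Matrix (Fin 2) (Fin 2) B) : B :=
  S 0 0 * T 1 1 - S 1 0 * T 0 1

/-- The commutation relations of the standard generators of `gl_2`. -/
def IsGl2 {B : Type*} [Ring B] (E : Matrix (Fin 2) (Fin 2) B) : Prop :=
  ∀ i j k l, E i j * E k l - E k l * E i j =
    (if k = j then E i l else 0) - (if i = l then E k j else 0)

theorem RTT.mul {B : Type*} [Ring B] {z : B} (hz : ∀ b, Commute z b)
    {S T S' T' : Matrix (Fin 2) (Fin 2) B} (hST : RTT z S T) (hST' : RTT z S' T')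
    (hS : ∀ i j k l, Commute (S' i j) (T k l)) (hT : ∀ i j k l, Commute (T' i j) (S k l)) :
    RTT z (S * S') (T * T') := by
  intro i j k l
  have key : ∀ a b, z * (S i a * S' a j * (T k b * T' b l) - T k b * T' b l * (S i a * S' a j)) =
      S k a * S' a j * (T i b * T' b l) - T k a * T' a j * (S i b * S' b l)
      + (T k a * S i b * T' a j * S' b l - T k a * S i b * S' a j * T' b l)
      + (T k b * S i a * S' b j * T' a l - T k b * S i a * T' b j * S' a l) := by
    intro a b
    have e1 : S i a * S' a j * (T k b * T' b l) - T k b * T' b l * (S i a * S' a j) =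
        (S i a * T k b - T k b * S i a) * (S' a j * T' b l) +
          T k b * S i a * (S' a j * T' b l - T' b l * S' a j) := by
      rw [mul_assoc (S i a), ← mul_assoc (S' a j), (hS a j k b).eq, mul_assoc (T k b) (T' b l),
        ← mul_assoc (T' b l), (hT b l i a).eq]
      noncomm_ring
    have e2 : ∀ x y c d : B, z * (x * y + c * d) = z * x * y + c * (z * d) := by
      intro x y c d
      rw [mul_add, ← mul_assoc, ← mul_assoc, (hz c).eq, mul_assoc c]
    rw [e1, e2, hST i a k b, hST' a j b l, mul_assoc (S k a) (S' a j), ← mul_assoc (S' a j),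
      (hS a j i b).eq, mul_assoc (T k a) (T' a j), ← mul_assoc (T' a j), (hT a j i b).eq]
    noncomm_ring
  simp only [Matrix.mul_apply, Fin.sum_univ_two, mul_add, add_mul]
  have := key 0 0
  have h01 := key 0 1
  have h10 := key 1 0
  have h11 := key 1 1
  simp only [mul_add, mul_sub] at *
  linear_combination (norm := abel) this + h01 + h10 + h11

theorem qdet_mul {B : Type*} [Ring B] {S T S' T' : Matrix (Fin 2) (Fin 2) B} (h : RTT 1 S T)
    (hS : ∀ i j k l, Commute (S' i j) (T k l)) :
    qdet (S * S') (T * T') = qdet S T * qdet S' T' := by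
  have key : ∀ a b, S 0 a * S' a 0 * (T 1 b * T' b 1) - S 1 a * S' a 0 * (T 0 b * T' b 1) =
      (S 0 a * T 1 b - S 1 a * T 0 b) * (S' a 0 * T' b 1) := by
    intro a b
    rw [mul_assoc (S 0 a), ← mul_assoc (S' a 0), (hS a 0 1 b).eq,
      mul_assoc (S 1 a), ← mul_assoc (S' a 0), (hS a 0 0 b).eq]
    noncomm_ring
  have c00 : S 0 0 * T 1 0 - S 1 0 * T 0 0 = 0 := by
    have := h 0 0 1 0
    rw [one_mul] at this
    linear_combination (norm := abel) this
  have c11 : S 0 1 * T 1 1 - S 1 1 * T 0 1 = 0 := by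
    have := h 0 1 1 1
    rw [one_mul] at this
    linear_combination (norm := abel) this
  have c10 : S 0 1 * T 1 0 - S 1 1 * T 0 0 = - qdet S T := by
    have h1 := h 0 1 1 0
    have h2 := h 0 0 1 1
    rw [one_mul] at h1 h2
    rw [qdet]
    linear_combination (norm := abel) h1 + h2
  have k00 := key 0 0
  have k01 := key 0 1
  have k10 := key 1 0
  have k11 := key 1 1
  rw [c00, zero_mul] at k00
  rw [c11, zero_mul] at k11
  rw [c10] at k10
  have c01 : S 0 0 * T 1 1 - S 1 0 * T 0 1 = qdet S T := rfl
  rw [c01] at k01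
  have e : qdet S T * qdet S' T' =
      qdet S T * (S' 0 0 * T' 1 1) + -qdet S T * (S' 1 0 * T' 0 1) := by
    rw [qdet, qdet]; noncomm_ring
  rw [e, ← k01, ← k10]
  simp only [qdet, Matrix.mul_apply, Fin.sum_univ_two]
  simp only [mul_add, add_mul] at *
  linear_combination (norm := abel) k00 + k11

/-- The matrix `u + E`. -/
def lax {B : Type*} [Ring B] (u : B) (E : Matrix (Fin 2) (Fin 2) B) : Matrix (Fin 2) (Fin 2) B :=
  Matrix.diagonal (fun _ => u) + E

theorem lax_apply {B : Type*} [Ring B] (u : B) (E : Matrix (Fin 2) (Fin 2) B) (i j : Fin 2) :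
    lax u E i j = (if i = j then u else 0) + E i j := by
  rw [lax, Matrix.add_apply, Matrix.diagonal_apply]

/-- The monodromy matrix `(u + E 0) (u + E 1) ⋯ (u + E (n - 1))`. -/
def monodromy {B : Type*} [Ring B] (E : ℕ → Matrix (Fin 2) (Fin 2) B) (u : B) :
    ℕ → Matrix (Fin 2) (Fin 2) B
  | 0 => 1
  | n + 1 => monodromy E u n * lax u (E n)

theorem monodromy_map {B B' : Type*} [Ring B] [Ring B'] (φ : B →+* B')
    (E : ℕ → Matrix (Fin 2) (Fin 2) B) (u : B) (n : ℕ) :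
    (monodromy E u n).map φ = monodromy (fun m => (E m).map φ) (φ u) n := by
  induction n with
  | zero => simp [monodromy]
  | succ n ih =>
    rw [monodromy, Matrix.map_mul, ih, monodromy, lax, Matrix.map_add φ (map_add φ),
      Matrix.diagonal_map (map_zero φ)]
    rfl

theorem commute_monodromy {B : Type*} [Ring B] {E : ℕ → Matrix (Fin 2) (Fin 2) B} {u x : B}
    (hu : Commute x u) (n : ℕ) (hx : ∀ m < n, ∀ i j, Commute x (E m i j)) (i j : Fin 2) :
    Commute x (monodromy E u n i j) := by
  induction n generalizing i j with
  | zero =>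
    rw [monodromy, Matrix.one_apply]
    split_ifs
    exacts [Commute.one_right x, Commute.zero_right x]
  | succ n ih =>
    rw [monodromy, Matrix.mul_apply]
    refine Commute.sum_right _ _ _ fun a _ => (ih (fun m hm => hx m (by omega)) i a).mul_right ?_
    rw [lax_apply]
    refine Commute.add_right ?_ (hx n (by omega) a j)
    split_ifs
    exacts [hu, Commute.zero_right x]

/-- Mutually commuting copies of `gl_2`. -/
structure IsGl2Chain {B : Type*} [Ring B] (E : ℕ → Matrix (Fin 2) (Fin 2) B) : Prop where
  gl2 : ∀ n, IsGl2 (E n)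
  comm : ∀ m n, m ≠ n → ∀ i j k l, Commute (E m i j) (E n k l)

theorem IsGl2.map {B B' : Type*} [Ring B] [Ring B'] (φ : B →+* B')
    {E : Matrix (Fin 2) (Fin 2) B} (h : IsGl2 E) : IsGl2 (E.map φ) := by
  intro i j k l
  have := congrArg φ (h i j k l)
  simpa [apply_ite φ] using this

theorem IsGl2Chain.map {B B' : Type*} [Ring B] [Ring B'] (φ : B →+* B')
    {E : ℕ → Matrix (Fin 2) (Fin 2) B} (h : IsGl2Chain E) :
    IsGl2Chain (fun n => (E n).map φ) :=
  ⟨fun n => (h.gl2 n).map φ, fun m n hmn i j k l => (h.comm m n hmn i j k l).map φ⟩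

theorem IsGl2.rtt {B : Type*} [Ring B] {E : Matrix (Fin 2) (Fin 2) B} (h : IsGl2 E) {u v : B}
    (hu : ∀ b, Commute u b) (hv : ∀ b, Commute v b) :
    RTT (u - v) (lax u E) (lax v E) := by
  intro i j k l
  simp only [lax_apply]
  have e : ∀ x y a b : B, (∀ c, Commute x c) → (∀ c, Commute y c) →
      (x + a) * (y + b) - (y + b) * (x + a) = a * b - b * a := by
    intro x y a b hx hy
    simp only [mul_add, add_mul]
    rw [(hx y).eq, (hx b).eq, (hy a).eq]
    abel
  have hite : ∀ (q : Prop) [Decidable q] (w : B), (∀ c, Commute w c) →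
      ∀ c, Commute (if q then w else 0) c := by
    intro q _ w hw c
    split_ifs
    exacts [hw c, Commute.zero_left c]
  rw [e _ _ _ _ (hite _ u hu) (hite _ v hv), h i j k l]
  by_cases h1 : k = j <;> by_cases h2 : i = l <;>
    simp only [h1, h2, if_true, if_false, zero_add, add_mul, mul_add, sub_mul, mul_sub,
      (hu v).eq, (hv (E _ _)).eq, (hu (E _ _)).eq, mul_zero] <;> abel

theorem IsGl2Chain.rtt {B : Type*} [Ring B] {E : ℕ → Matrix (Fin 2) (Fin 2) B}
    (h : IsGl2Chain E) {u v : B} (hu : ∀ b, Commute u b) (hv : ∀ b, Commute v b) (n : ℕ) :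
    RTT (u - v) (monodromy E u n) (monodromy E v n) := by
  have hc : ∀ n w w' : _, (∀ b : B, Commute w b) → (∀ b : B, Commute w' b) → ∀ i j k l, Commute
      (lax w (E n) i j) (monodromy E w' n k l) := by
    intro n w w' hw hw' i j k l
    refine commute_monodromy (hw' _).symm n (fun m hm a b => ?_) k l
    rw [lax_apply]
    refine Commute.add_left ?_ (h.comm n m (by omega) i j a b)
    split_ifs
    exacts [hw _, Commute.zero_left _]
  induction n with
  | zero =>
    intro i j k l
    fin_cases i <;> fin_cases j <;> fin_cases k <;> fin_cases l <;> simp [monodromy]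
  | succ n ih =>
    exact ih.mul (fun b => (hu b).sub_left (hv b)) ((h.gl2 n).rtt hu hv) (hc n u v hu hv)
      (hc n v u hv hu)

theorem IsGl2Chain.qdet_monodromy {B : Type*} [Ring B] {E : ℕ → Matrix (Fin 2) (Fin 2) B}
    (h : IsGl2Chain E) {u : B} (hu : ∀ b, Commute u b) (n : ℕ) :
    qdet (monodromy E u (n + 1)) (monodromy E (u - 1) (n + 1)) =
      qdet (monodromy E u n) (monodromy E (u - 1) n) *
        qdet (lax u (E n)) (lax (u - 1) (E n)) := by
  have hv : ∀ b, Commute (u - 1) b := fun b => (hu b).sub_left (Commute.one_left b)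
  have hr := h.rtt hu hv n
  rw [sub_sub_cancel] at hr
  refine qdet_mul hr fun i j k l => commute_monodromy (hv _).symm n (fun m hm a b => ?_) k l
  rw [lax_apply]
  refine Commute.add_left ?_ (h.comm n m (by omega) i j a b)
  split_ifs
  exacts [hu _, Commute.zero_left _]

theorem commutator_eq_sum_of_step {A : Type*} [Ring A] {N : ℕ} {t : Fin 2 → Fin 2 → ℕ → A}
    (ht : ∀ i j, t i j 0 = if i = j then 1 else 0)
    (step : ∀ i j k l r s, r < N → s < N →
      (t i j (r + 1) * t k l s - t k l s * t i j (r + 1)) -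
        (t i j r * t k l (s + 1) - t k l (s + 1) * t i j r) =
      t k j r * t i l s - t k j s * t i l r)
    (i j k l : Fin 2) (r s : ℕ) (hrs : r + s ≤ N) :
    t i j r * t k l s - t k l s * t i j r = ∑ a ∈ Finset.Icc 1 (min r s),
      (t k j (a - 1) * t i l (r + s - a) - t k j (r + s - a) * t i l (a - 1)) := by
  rcases le_total r s with h | h
  · rw [min_eq_left h]
    clear h
    induction r generalizing s with
    | zero => rw [ht]; split_ifs <;> simp
    | succ r ih =>
      rw [Finset.sum_Icc_succ_top (by omega), show r + 1 + s = r + (s + 1) by omega,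
        ← ih (s + 1) (by omega), show r + 1 - 1 = r by omega,
        show r + (s + 1) - (r + 1) = s by omega, ← step i j k l r s (by omega) (by omega)]
      abel
  · rw [min_eq_right h]
    clear h
    induction s generalizing r with
    | zero => rw [ht]; split_ifs <;> simp
    | succ s ih =>
      rw [Finset.sum_Icc_succ_top (by omega), show r + (s + 1) = r + 1 + s by omega,
        ← ih (r + 1) (by omega), show s + 1 - 1 = s by omega,
        show r + 1 + s - (s + 1) = r by omega]
      linear_combination (norm := abel) -step i j k l r s (by omega) (by omega)

theorem RTT.coeff {A : Type*} [Ring A] {P : Matrix (Fin 2) (Fin 2) A[X]}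
    (h : RTT (C X - X : A[X][X]) (P.map C) (P.map (mapRingHom C))) (i j k l : Fin 2) (a b : ℕ) :
    ((P i j).coeff a * (P k l).coeff (b + 1) - (P k l).coeff (b + 1) * (P i j).coeff a) -
      ((P i j).coeff (a + 1) * (P k l).coeff b - (P k l).coeff b * (P i j).coeff (a + 1)) =
    (P k j).coeff (a + 1) * (P i l).coeff (b + 1) -
      (P k j).coeff (b + 1) * (P i l).coeff (a + 1) := by
  have := congrArg (fun q : A[X][X] => (q.coeff (b + 1)).coeff (a + 1)) (h i j k l)
  rw [sub_sub_sub_comm]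
  simpa [sub_mul, mul_sub, coeff_X_mul] using this

theorem RTT.X_pow_smul {A : Type*} [Ring A] {P : Matrix (Fin 2) (Fin 2) A[X]}
    (h : RTT (C X - X : A[X][X]) (P.map C) (P.map (mapRingHom C))) (n : ℕ) :
    RTT (C X - X : A[X][X]) ((P.map (X ^ n * ·)).map C)
      ((P.map (X ^ n * ·)).map (mapRingHom C)) := by
  intro i j k l
  have hx : ∀ q : A[X][X], Commute ((C X) ^ n : A[X][X]) q := fun q => by
    refine Commute.pow_left ?_ n
    ext1 m
    simp [X_mul]
  have hy : ∀ q : A[X][X], Commute (X ^ n : A[X][X]) q := fun q => (commute_X q).pow_left n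
  have e : ∀ f g : A[X], C (X ^ n * f) * mapRingHom C (X ^ n * g) =
      (C X) ^ n * X ^ n * (C f * mapRingHom C g) := by
    intro f g
    simp only [map_mul, map_pow, coe_mapRingHom, map_X]
    rw [mul_assoc, ← mul_assoc (C f), ← (hy (C f)).eq]
    noncomm_ring
  have e' : ∀ f g : A[X], mapRingHom C (X ^ n * f) * C (X ^ n * g) =
      (C X) ^ n * X ^ n * (mapRingHom C f * C g) := by
    intro f g
    simp only [map_mul, map_pow, coe_mapRingHom, map_X]
    rw [mul_assoc, ← mul_assoc (map C f), ← (hx (map C f)).eq, ← mul_assoc, ← mul_assoc,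
      ← (hx (X ^ n)).eq]
    noncomm_ring
  have hc : Commute (C X - X : A[X][X]) ((C X) ^ n * X ^ n) :=
    ((hx _).mul_left (hy _)).symm
  simp only [Matrix.map_apply, e, e']
  rw [← mul_sub, ← mul_assoc, hc.eq, mul_assoc, ← mul_sub]
  exact congrArg _ (h i j k l)

theorem IsGl2Chain.rtt_map_C {A : Type*} [Ring A] {E : ℕ → Matrix (Fin 2) (Fin 2) A}
    (h : IsGl2Chain E) (n : ℕ) :
    RTT (C X - X : A[X][X]) ((monodromy (fun m => (E m).map C) X n).map C)
      ((monodromy (fun m => (E m).map C) X n).map (mapRingHom C)) := by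
  have e : (fun m => ((E m).map C).map (mapRingHom (C : A →+* A[X]))) =
      fun m => ((E m).map C).map C := by
    ext; simp
  rw [monodromy_map, monodromy_map, e, coe_mapRingHom, map_X]
  refine ((h.map C).map C).rtt (fun q => ?_) (fun q => commute_X q) n
  ext1 m
  simp [X_mul]

theorem coeff_monodromy {A : Type*} [Ring A] (E : ℕ → Matrix (Fin 2) (Fin 2) A) {n m : ℕ}
    (hm : n ≤ m) (i j : Fin 2) :
    (monodromy (fun m => (E m).map C) X n i j).coeff m =
      if m = n ∧ i = j then 1 else 0 := by
  induction n generalizing m i j with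
  | zero =>
    by_cases hij : i = j <;> simp [monodromy, Matrix.one_apply, hij, coeff_one]
  | succ n ih =>
    obtain ⟨m, rfl⟩ : ∃ m', m = m' + 1 := ⟨m - 1, by omega⟩
    have h0 := fun i j => ih (m := m) (by omega) i j
    have h1 := fun i j => ih (m := m + 1) (by omega) i j
    have hn : m + 1 ≠ n := by omega
    fin_cases j <;> simp [monodromy, Matrix.mul_apply, lax_apply, mul_add, h0, h1, hn]

/-- The homomorphism from the free algebra sending `t_{ij}^{(r)}` to the coefficient of
`u ^ (p - r)` in the monodromy matrix. -/
noncomputable def monodromyLift (K : Type) [Field K] (p : ℕ) {A : Type*} [Ring A] [Algebra K A]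
    (E : ℕ → Matrix (Fin 2) (Fin 2) A) : FreeAlgebra K (YGen p) →ₐ[K] A :=
  FreeAlgebra.lift K fun g =>
    (monodromy (fun m => (E m).map C) X p g.1 g.2.1).coeff (p - (g.2.2 + 1))

theorem monodromyLift_tF (K : Type) [Field K] (p : ℕ) {A : Type*} [Ring A] [Algebra K A]
    (E : ℕ → Matrix (Fin 2) (Fin 2) A) (i j : Fin 2) (r : ℕ) (hr : r ≤ 2 * p) :
    monodromyLift K p E (tF K p i j r) =
      ((monodromy (fun m => (E m).map C) X p).map (X ^ p * ·) i j).coeff (2 * p - r) := by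
  rw [Matrix.map_apply, coeff_X_pow_mul', tF]
  split_ifs with h0 hij h1 h2 h3 <;> try omega
  · subst h0 hij
    rw [coeff_monodromy E (by omega), if_pos ⟨by omega, rfl⟩, map_one]
  · subst h0
    rw [coeff_monodromy E (by omega), if_neg (fun h => hij h.2), map_zero]
  · rw [monodromyLift, FreeAlgebra.lift_ι_apply]
    congr 1
    dsimp only
    omega
  · exact map_zero _

theorem IsGl2Chain.monodromyLift_rel {K : Type} [Field K] {A : Type*} [Ring A]
    [Algebra K A] {E : ℕ → Matrix (Fin 2) (Fin 2) A} (h : IsGl2Chain E) (p : ℕ)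
    ⦃x y : FreeAlgebra K (YGen p)⦄ (hxy : YRel K p x y) :
    monodromyLift K p E x = monodromyLift K p E y := by
  obtain ⟨i, j, k, l, r, s, hr, hr', hs, hs'⟩ := hxy
  set Q := (monodromy (fun m => (E m).map C) X p).map (X ^ p * ·) with hQ
  have key := commutator_eq_sum_of_step (N := 2 * p) (t := fun i j r => (Q i j).coeff (2 * p - r))
    (fun i j => by
      rw [← monodromyLift_tF K p E i j 0 (by omega), tF, dif_pos rfl]
      split_ifs
      exacts [map_one _, map_zero _])
    (fun i j k l r s hr hs => by
      have := ((h.rtt_map_C p).X_pow_smul p).coeff i j k l (2 * p - (r + 1)) (2 * p - (s + 1))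
      rwa [show 2 * p - (r + 1) + 1 = 2 * p - r by omega,
        show 2 * p - (s + 1) + 1 = 2 * p - s by omega] at this)
    i j k l r s (by omega)
  have ht : ∀ i j r, r ≤ 2 * p → monodromyLift K p E (tF K p i j r) = (Q i j).coeff (2 * p - r) :=
    monodromyLift_tF K p E
  rw [map_sub, map_mul, map_mul, ht _ _ _ (by omega), ht _ _ _ (by omega), key, map_sum]
  refine Finset.sum_congr rfl fun a ha => ?_
  rw [Finset.mem_Icc] at ha
  rw [map_sub, map_mul, map_mul, ht _ _ _ (by omega), ht _ _ _ (by omega), ht _ _ _ (by omega),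
    ht _ _ _ (by omega)]

/-- The representation of the Yangian given by a chain of commuting copies of `gl_2`. -/
noncomputable def monodromyHom (K : Type) [Field K] (p : ℕ) {A : Type*} [Ring A] [Algebra K A]
    {E : ℕ → Matrix (Fin 2) (Fin 2) A} (h : IsGl2Chain E) : Yp K p →ₐ[K] A :=
  RingQuot.liftAlgHom K ⟨monodromyLift K p E, h.monodromyLift_rel p⟩

theorem monodromyHom_tY {K : Type} [Field K] {p : ℕ} {A : Type*} [Ring A] [Algebra K A]
    {E : ℕ → Matrix (Fin 2) (Fin 2) A} (h : IsGl2Chain E) (i j : Fin 2) {r : ℕ} (hr : 1 ≤ r)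
    (hr' : r ≤ p) : monodromyHom K p h (tY K p i j r) =
      (monodromy (fun m => (E m).map C) X p i j).coeff (p - r) := by
  rw [monodromyHom, tY, RingQuot.liftAlgHom_mkAlgHom_apply, tF, dif_neg (by omega), dif_pos hr',
    monodromyLift, FreeAlgebra.lift_ι_apply]
  congr 1
  dsimp only
  omega

theorem map_monodromyHom_TY {K : Type} [Field K] {p : ℕ} {A : Type*} [Ring A] [Algebra K A]
    {E : ℕ → Matrix (Fin 2) (Fin 2) A} (h : IsGl2Chain E) (i j : Fin 2) :
    (TY K p i j).map (monodromyHom K p h : Yp K p →+* A) =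
      monodromy (fun m => (E m).map C) X p i j := by
  ext m
  have e : ∀ k ∈ Finset.Icc 1 p, ((C (tY K p i j k) * X ^ (p - k)).map
      (monodromyHom K p h : Yp K p →+* A)).coeff m =
      if p - m = k then (monodromy (fun m => (E m).map C) X p i j).coeff m
      else 0 := by
    intro k hk
    rw [Finset.mem_Icc] at hk
    rw [Polynomial.map_mul, map_C, Polynomial.map_pow, map_X, coeff_C_mul_X_pow, RingHom.coe_coe,
      monodromyHom_tY h i j hk.1 hk.2]
    by_cases hm : m ≤ p
    · by_cases hk' : p - m = k
      · rw [if_pos (by omega), if_pos hk', show p - k = m by omega]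
      · rw [if_neg (by omega), if_neg hk']
    · rw [if_neg (by omega), if_neg (by omega)]
  have hX : ((if i = j then X ^ p else 0 : (Yp K p)[X]).map
      (monodromyHom K p h : Yp K p →+* A)).coeff m = if m = p ∧ i = j then 1 else 0 := by
    by_cases hij : i = j <;> simp [hij, coeff_X_pow]
  rw [TY, Polynomial.map_add, Polynomial.map_sum, coeff_add, finsetSum_coeff,
    Finset.sum_congr rfl e, Finset.sum_ite_eq, hX]
  rcases le_or_gt p m with hm | hm
  · rw [coeff_monodromy E hm, if_neg (c := p - m ∈ _) (by simp; omega), add_zero]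
  · rw [if_neg (by omega), if_pos (by simp; omega), zero_add]

theorem map_monodromyHom_DY {K : Type} [Field K] {p : ℕ} {A : Type*} [Ring A] [Algebra K A]
    {E : ℕ → Matrix (Fin 2) (Fin 2) A} (h : IsGl2Chain E) :
    (DY K p).map (monodromyHom K p h : Yp K p →+* A) =
      qdet (monodromy (fun m => (E m).map C) X p)
        (monodromy (fun m => (E m).map C) (X - 1) p) := by
  have hcomp : ∀ i j, (monodromy (fun m => (E m).map C) X p i j).comp (X - 1) =
      monodromy (fun m => (E m).map C) (X - 1) p i j := by
    intro i j
    let φ : A[X] →+* A[X] := eval₂RingHom' C (X - 1)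
      fun a => (commute_X (C a)).symm.sub_right (Commute.one_right _)
    have := congrFun (congrFun (monodromy_map φ (fun m => (E m).map C) X p) i) j
    have e : (fun m => ((E m).map C).map φ) = fun m => (E m).map C := by
      ext1 m
      ext1 i j
      exact eval₂_C _ _
    have eX : φ X = X - 1 := eval₂_X _ _
    rw [e, eX] at this
    exact this
  rw [DY, Polynomial.map_sub, Polynomial.map_mul, Polynomial.map_mul, map_comp, map_comp,
    Polynomial.map_sub, map_X, Polynomial.map_one]
  simp only [map_monodromyHom_TY, hcomp]
  rfl

/-- Functions on `ℕ` copies of affine three-space, with coordinates `(n, 0)`, `(n, 1)`, `(n, 2)`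
on the `n`-th copy. -/
abbrev SiteRing (K : Type) [Field K] := MvPolynomial (ℕ × Fin 3) K

/-- The substitution translating the variable `(n, 0)` by `-e`. -/
noncomputable def siteShift (K : Type) [Field K] (n : ℕ) (e : K) : SiteRing K →ₐ[K] SiteRing K :=
  MvPolynomial.aeval fun v =>
    if v = (n, 0) then MvPolynomial.X v - MvPolynomial.C e else MvPolynomial.X v

theorem siteShift_X (K : Type) [Field K] (n : ℕ) (e : K) (v : ℕ × Fin 3) :
    siteShift K n e (MvPolynomial.X v) =
      if v = (n, 0) then MvPolynomial.X v - MvPolynomial.C e else MvPolynomial.X v :=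
  MvPolynomial.aeval_X _ _

theorem siteShift_siteShift_neg (K : Type) [Field K] (n : ℕ) (e : K) (f : SiteRing K) :
    siteShift K n e (siteShift K n (-e) f) = f := by
  have : (siteShift K n e).comp (siteShift K n (-e)) = AlgHom.id K _ := by
    ext1 v
    by_cases hv : v = (n, 0) <;> simp [siteShift_X, hv, MvPolynomial.algHom_C]
  exact DFunLike.congr_fun this f

theorem siteShift_comm (K : Type) [Field K] {m n : ℕ} (hmn : m ≠ n) (d e : K) (f : SiteRing K) :
    siteShift K m d (siteShift K n e f) = siteShift K n e (siteShift K m d f) := by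
  have : (siteShift K m d).comp (siteShift K n e) =
      (siteShift K n e).comp (siteShift K m d) := by
    ext1 v
    by_cases hm : v = (m, 0) <;> by_cases hn : v = (n, 0) <;>
      simp [siteShift_X, hm, hn, hmn, hmn.symm, ← MvPolynomial.algebraMap_eq]
  exact DFunLike.congr_fun this f

/-- The coefficient of the raising operator. -/
noncomputable def siteCoeff (K : Type) [Field K] (n : ℕ) : SiteRing K :=
  -(MvPolynomial.X (n, 0) - MvPolynomial.X (n, 1)) *
    (MvPolynomial.X (n, 0) - MvPolynomial.X (n, 2))

/-- The action of `gl_2` by difference operators in the variables of the `n`-th copy. -/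
noncomputable def siteGl2 (K : Type) [Field K] (n : ℕ) :
    Matrix (Fin 2) (Fin 2) (Module.End K (SiteRing K)) :=
  !![Algebra.lmul K _ (1 + MvPolynomial.X (n, 1) + MvPolynomial.X (n, 2) - MvPolynomial.X (n, 0)),
      Algebra.lmul K _ (siteCoeff K n) * (siteShift K n (-1)).toLinearMap;
    (siteShift K n 1).toLinearMap, Algebra.lmul K _ (MvPolynomial.X (n, 0))]

theorem siteGl2_mul (K : Type) [Field K] (n : ℕ) :
    siteGl2 K n 1 0 * siteGl2 K n 0 1 = Algebra.lmul K _ (-(MvPolynomial.X (n, 0) - 1 -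
      MvPolynomial.X (n, 1)) * (MvPolynomial.X (n, 0) - 1 - MvPolynomial.X (n, 2))) := by
  refine LinearMap.ext fun f => ?_
  simp [siteGl2, siteCoeff, siteShift_X, siteShift_siteShift_neg]

theorem siteGl2_isGl2 (K : Type) [Field K] (n : ℕ) : IsGl2 (siteGl2 K n) := by
  have hs : ∀ f, siteShift K n (-1) (siteShift K n 1 f) = f := fun f => by
    simpa using siteShift_siteShift_neg K n (-1) f
  intro i j k l
  refine LinearMap.ext fun f => ?_
  fin_cases i <;> fin_cases j <;> fin_cases k <;> fin_cases l <;>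
    simp [siteGl2, siteCoeff, siteShift_X, siteShift_siteShift_neg, hs] <;> ring

theorem siteGl2_commute (K : Type) [Field K] {m n : ℕ} (hmn : m ≠ n) (i j k l : Fin 2) :
    Commute (siteGl2 K m i j) (siteGl2 K n k l) := by
  refine LinearMap.ext fun f => ?_
  fin_cases i <;> fin_cases j <;> fin_cases k <;> fin_cases l <;>
    simp [siteGl2, siteCoeff, siteShift_X, hmn, hmn.symm, siteShift_comm K hmn] <;> ring

/-- The twist of a matrix by the diagonal matrix with entries `1` and `w ^ e`, where `w` is the
Laurent variable. -/
noncomputable def laurentTwist {R : Type*} [Ring R] (e : ℤ) (E : Matrix (Fin 2) (Fin 2) R) :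
    Matrix (Fin 2) (Fin 2) (LaurentPolynomial R) :=
  fun i j => LaurentPolynomial.C (E i j) * LaurentPolynomial.T (e * ((j : ℤ) - (i : ℤ)))

theorem laurentTwist_apply {R : Type*} [Ring R] (e : ℤ) (E : Matrix (Fin 2) (Fin 2) R)
    (i j : Fin 2) : laurentTwist e E i j =
      LaurentPolynomial.C (E i j) * LaurentPolynomial.T (e * ((j : ℤ) - (i : ℤ))) := rfl

theorem C_mul_T_mul_C_mul_T {R : Type*} [Ring R] (a b : R) (m n : ℤ) :
    (LaurentPolynomial.C a * LaurentPolynomial.T m) *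
      (LaurentPolynomial.C b * LaurentPolynomial.T n) =
    LaurentPolynomial.C (a * b) * LaurentPolynomial.T (m + n) := by
  rw [LaurentPolynomial.T_add, map_mul, mul_assoc, ← mul_assoc (LaurentPolynomial.T m),
    LaurentPolynomial.T_mul m]
  simp only [mul_assoc]

theorem IsGl2.laurentTwist {R : Type*} [Ring R] {E : Matrix (Fin 2) (Fin 2) R} (h : IsGl2 E)
    (e : ℤ) : IsGl2 (laurentTwist e E) := by
  intro i j k l
  simp only [laurentTwist_apply]
  rw [C_mul_T_mul_C_mul_T, C_mul_T_mul_C_mul_T,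
    add_comm (e * ((l : ℤ) - (k : ℤ))), ← sub_mul, ← map_sub, h i j k l, map_sub, sub_mul]
  congr 1 <;> split_ifs with hc
  · rw [hc]
    congr 2
    ring
  · rw [map_zero, zero_mul]
  · rw [hc]
    congr 2
    ring
  · rw [map_zero, zero_mul]

/-- A chain of copies of `gl_2` with diagonal generators `1 + y + z - x` and `x`, and with
quantum determinant `(u + y) (u + z)`, the parameters lying in a commutative ring `S`. -/
structure IsDifferenceChain {R S : Type*} [Ring R] [CommRing S] (ι : S →+* R) (x y z : ℕ → S)
    (E : ℕ → Matrix (Fin 2) (Fin 2) R) : Prop extends IsGl2Chain E where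
  apply_zero_zero : ∀ n, E n 0 0 = ι (1 + y n + z n - x n)
  apply_one_one : ∀ n, E n 1 1 = ι (x n)
  mul_eq : ∀ n, E n 1 0 * E n 0 1 = ι (-(x n - 1 - y n) * (x n - 1 - z n))

theorem siteGl2_isDifferenceChain (K : Type) [Field K] :
    IsDifferenceChain (Algebra.lmul K (SiteRing K) : SiteRing K →+* Module.End K (SiteRing K))
      (fun n => MvPolynomial.X (n, 0)) (fun n => MvPolynomial.X (n, 1))
      (fun n => MvPolynomial.X (n, 2)) (siteGl2 K) where
  gl2 := siteGl2_isGl2 K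
  comm _ _ hmn := siteGl2_commute K hmn
  apply_zero_zero _ := rfl
  apply_one_one _ := rfl
  mul_eq := siteGl2_mul K

section DifferenceChain

variable {R S : Type*} [Ring R] [CommRing S] {ι : S →+* R} {x y z : ℕ → S}
  {E : ℕ → Matrix (Fin 2) (Fin 2) R}

theorem IsDifferenceChain.laurentTwist (h : IsDifferenceChain ι x y z E) :
    IsDifferenceChain (LaurentPolynomial.C.comp ι) x y z fun n => laurentTwist (n + 1) (E n) where
  gl2 n := (h.gl2 n).laurentTwist _
  comm m n hmn i j k l := by
    rw [commute_iff_eq, laurentTwist_apply, laurentTwist_apply,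
      C_mul_T_mul_C_mul_T, C_mul_T_mul_C_mul_T, (h.comm m n hmn i j k l).eq, add_comm]
  apply_zero_zero n := by simp [laurentTwist_apply, h.apply_zero_zero]
  apply_one_one n := by simp [laurentTwist_apply, h.apply_one_one]
  mul_eq n := by
    rw [laurentTwist_apply, laurentTwist_apply, C_mul_T_mul_C_mul_T, h.mul_eq]
    simp

theorem IsDifferenceChain.qdet_lax (h : IsDifferenceChain ι x y z E) (n : ℕ) :
    qdet (lax X ((E n).map C)) (lax (X - 1) ((E n).map C)) =
      ((X + C (y n)) * (X + C (z n))).map ι := by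
  have e : ∀ q, C (ι q) = (C q).map ι := fun q => (map_C _).symm
  have eX : (X : R[X]) = X.map ι := (map_X _).symm
  simp only [qdet, lax_apply, Matrix.map_apply, if_true, one_ne_zero, zero_ne_one, if_false,
    zero_add, ← C_mul, h.apply_zero_zero, h.apply_one_one, h.mul_eq, e]
  rw [eX, ← Polynomial.map_one ι, ← Polynomial.map_sub, ← Polynomial.map_add,
    ← Polynomial.map_add, ← Polynomial.map_mul, ← Polynomial.map_sub]
  congr 1
  simp only [map_add, map_sub, map_neg, map_mul, map_one]
  ring

theorem IsDifferenceChain.qdet_monodromy (h : IsDifferenceChain ι x y z E) (n : ℕ) :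
    qdet (monodromy (fun m => (E m).map C) X n) (monodromy (fun m => (E m).map C) (X - 1) n) =
      (∏ m ∈ Finset.range n, ((X + C (y m)) * (X + C (z m)))).map ι := by
  induction n with
  | zero => simp [qdet, monodromy]
  | succ n ih =>
    rw [(h.toIsGl2Chain.map C).qdet_monodromy (fun q => commute_X q) n, ih, h.qdet_lax,
      Finset.prod_range_succ, ← Polynomial.map_mul]

/-- The bottom row of the twisted monodromy matrix is polynomial in the twisting variable `w`,
after rescaling, and its diagonal entry degenerates at `w = 0` to a product. -/
theorem IsDifferenceChain.exists_monodromy_laurentTwist (h : IsDifferenceChain ι x y z E)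
    (n : ℕ) : ∃ P Q : R[X][X],
      monodromy (fun m => (_root_.laurentTwist (m + 1) (E m)).map C) X n 1 0 *
        C (LaurentPolynomial.T n) = P.map toLaurent ∧
      monodromy (fun m => (_root_.laurentTwist (m + 1) (E m)).map C) X n 1 1 = Q.map toLaurent ∧
      Q.map constantCoeff = (∏ m ∈ Finset.range n, (X + C (x m))).map ι := by
  induction n with
  | zero => exact ⟨0, 1, by simp [monodromy], by simp [monodromy], by simp⟩
  | succ n ih =>
    obtain ⟨P, Q, hP, hQ, hQ0⟩ := ih
    refine ⟨P * (X + C (C (E n 0 0))) * C X + Q * C (C (E n 1 0)),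
      P * C (C (E n 0 1) * X) + Q * (X + C (C (E n 1 1))), ?_, ?_, ?_⟩
    · have e1 : C (LaurentPolynomial.T n) * (X + C (LaurentPolynomial.C (E n 0 0))) *
          C (LaurentPolynomial.T 1) = (X + C (LaurentPolynomial.C (E n 0 0))) *
          C (LaurentPolynomial.T (n + 1)) := by
        rw [mul_add, ← (commute_X (C _)).eq, ← C_mul, LaurentPolynomial.T_mul, C_mul, ← add_mul,
          mul_assoc, ← C_mul, ← LaurentPolynomial.T_add]
      have e2 : _root_.laurentTwist (n + 1) (E n) 1 0 * LaurentPolynomial.T (n + 1) =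
          LaurentPolynomial.C (E n 1 0) := by
        simp [laurentTwist_apply, LaurentPolynomial.mul_T_assoc]
      have e3 : _root_.laurentTwist (n + 1) (E n) 0 0 = LaurentPolynomial.C (E n 0 0) := by
        simp [laurentTwist_apply]
      simp only [Polynomial.map_add, Polynomial.map_mul, map_C, map_X, toLaurent_C, toLaurent_X,
        ← hP, ← hQ]
      rw [mul_assoc, mul_assoc, ← mul_assoc (C _), e1, monodromy, Matrix.mul_apply,
        Fin.sum_univ_two, lax_apply, lax_apply, if_pos rfl, if_neg (by decide), zero_add,
        Matrix.map_apply, Matrix.map_apply, add_mul, ← e2, e3, C_mul]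
      push_cast
      simp only [mul_assoc]
    · have e1 : _root_.laurentTwist (n + 1) (E n) 0 1 = LaurentPolynomial.T n *
          (LaurentPolynomial.C (E n 0 1) * LaurentPolynomial.T 1) := by
        rw [← mul_assoc, LaurentPolynomial.T_mul, mul_assoc, ← LaurentPolynomial.T_add]
        simp [laurentTwist_apply]
      have e3 : _root_.laurentTwist (n + 1) (E n) 1 1 = LaurentPolynomial.C (E n 1 1) := by
        simp [laurentTwist_apply]
      simp only [Polynomial.map_add, Polynomial.map_mul, map_C, map_X, toLaurent_C, toLaurent_X,
        map_mul, ← hP, ← hQ]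
      rw [monodromy, Matrix.mul_apply, Fin.sum_univ_two, lax_apply, lax_apply, if_pos rfl,
        if_neg (by decide), zero_add, Matrix.map_apply, Matrix.map_apply, e1, e3]
      simp only [mul_assoc, C_mul]
    · rw [Finset.prod_range_succ, Polynomial.map_mul, ← hQ0]
      simp [constantCoeff, h.apply_one_one]

end DifferenceChain

/-- Evaluation of a commutative polynomial at a family of elements of a noncommutative algebra,
multiplying the variables of each monomial in increasing order. -/
noncomputable def orderedEval {K A : Type*} [Field K] [Ring A] [Algebra K A] {n : ℕ}
    (f : Fin n → A) (P : MvPolynomial (Fin n) K) : A :=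
  ∑ m ∈ P.support, algebraMap K A (MvPolynomial.coeff m P) *
    ((List.finRange n).map (fun i => f i ^ m i)).prod

theorem map_orderedEval {K A B : Type*} [Field K] [Ring A] [Algebra K A] [Ring B] [Algebra K B]
    {n : ℕ} (φ : A →+* B) (hφ : ∀ c, φ (algebraMap K A c) = algebraMap K B c) (f : Fin n → A)
    (P : MvPolynomial (Fin n) K) : φ (orderedEval f P) = orderedEval (fun i => φ (f i)) P := by
  simp [orderedEval, map_list_prod, hφ, Function.comp_def]

theorem algHom_orderedEval {K A B : Type*} [Field K] [Ring A] [Algebra K A] [Ring B]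
    [Algebra K B] {n : ℕ} (φ : A →ₐ[K] B) (f : Fin n → A) (P : MvPolynomial (Fin n) K) :
    φ (orderedEval f P) = orderedEval (fun i => φ (f i)) P :=
  map_orderedEval (φ : A →+* B) φ.commutes f P

theorem orderedEval_eq_aeval {K A : Type*} [Field K] [CommRing A] [Algebra K A] {n : ℕ}
    (f : Fin n → A) (P : MvPolynomial (Fin n) K) : orderedEval f P = MvPolynomial.aeval f P := by
  rw [orderedEval, MvPolynomial.aeval_def, MvPolynomial.eval₂_eq']
  refine Finset.sum_congr rfl fun m _ => ?_
  rw [← List.ofFn_eq_map, List.prod_ofFn]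

theorem exists_prod_X_add_C_eq {F : Type*} [Field F] [IsAlgClosed F] {n : ℕ} {f : F[X]}
    (hf : f.Monic) (hn : f.natDegree = n) :
    ∃ r : ℕ → F, ∏ m ∈ Finset.range n, (X + C (r m)) = f := by
  induction n generalizing f with
  | zero => exact ⟨0, by simp [hf.natDegree_eq_zero.mp hn]⟩
  | succ n ih =>
    obtain ⟨a, ha⟩ := IsAlgClosed.exists_root f (by
      rw [degree_eq_natDegree hf.ne_zero, hn]
      exact_mod_cast n.succ_ne_zero)
    obtain ⟨g, rfl⟩ := dvd_iff_isRoot.mpr ha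
    have hg : g.Monic := (monic_X_sub_C a).of_mul_monic_left hf
    rw [(monic_X_sub_C a).natDegree_mul hg, natDegree_X_sub_C] at hn
    obtain ⟨r, hr⟩ := ih hg (by omega)
    refine ⟨fun m => if m = n then -a else r m, ?_⟩
    rw [Finset.prod_range_succ]
    dsimp only
    rw [if_pos rfl, ← hr, mul_comm, C_neg, ← sub_eq_add_neg]
    congr 1
    refine Finset.prod_congr rfl fun m hm => ?_
    rw [if_neg (Finset.mem_range.mp hm).ne]

theorem exists_coeff_prod_X_add_C_eq {F : Type*} [Field F] [IsAlgClosed F] (n : ℕ) (c : ℕ → F) :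
    ∃ r : ℕ → F, ∀ i < n, (∏ m ∈ Finset.range n, (X + C (r m))).coeff (n - (i + 1)) = c i := by
  set g : F[X] := ∑ k ∈ Finset.range n, C (c (n - 1 - k)) * X ^ k
  have hg : g.degree < n := by
    refine (degree_sum_le _ _).trans_lt ((Finset.sup_lt_iff (WithBot.bot_lt_coe n)).mpr ?_)
    intro k hk
    exact (degree_C_mul_X_pow_le _ _).trans_lt (WithBot.coe_lt_coe.mpr (Finset.mem_range.mp hk))
  obtain ⟨r, hr⟩ := exists_prod_X_add_C_eq (monic_X_pow_add hg)
    (n := n) (natDegree_eq_of_degree_eq_some (by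
      rw [degree_add_eq_left_of_degree_lt (by rwa [degree_X_pow]), degree_X_pow]))
  refine ⟨r, fun i hi => ?_⟩
  rw [hr, coeff_add, coeff_X_pow, if_neg (by omega), zero_add, finsetSum_coeff]
  simp only [coeff_C_mul_X_pow]
  rw [Finset.sum_ite_eq, if_pos (Finset.mem_range.mpr (by omega))]
  congr 1
  omega

theorem prod_range_two_mul {M : Type*} [CommMonoid M] (f : ℕ → M) (n : ℕ) :
    ∏ m ∈ Finset.range (2 * n), f m = ∏ m ∈ Finset.range n, (f (2 * m) * f (2 * m + 1)) := by
  induction n with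
  | zero => simp
  | succ n ih =>
    rw [mul_add, mul_one, Finset.prod_range_succ, Finset.prod_range_succ, ih,
      Finset.prod_range_succ, mul_assoc]

/-- The coefficients of the polynomials `∏ (u + x m)` and `∏ (u + y m) (u + z m)`. -/
noncomputable def siteGen (K : Type) [Field K] (p : ℕ) (i : Fin (3 * p)) : SiteRing K :=
  if (i : ℕ) < p then
    (∏ m ∈ Finset.range p, (X + C (MvPolynomial.X (m, 0))) : (SiteRing K)[X]).coeff (p - (i + 1))
  else
    (∏ m ∈ Finset.range p, ((X + C (MvPolynomial.X (m, 1))) * (X + C (MvPolynomial.X (m, 2)))) :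
      (SiteRing K)[X]).coeff
        (2 * p - ((i : ℕ) - p + 1))

theorem siteGen_algebraicIndependent (K : Type) [Field K] (p : ℕ) :
    AlgebraicIndependent K (siteGen K p) := by
  rw [algebraicIndependent_iff]
  intro P hP
  let F := AlgebraicClosure K
  refine MvPolynomial.map_injective _ (algebraMap K F).injective ?_
  rw [map_zero]
  refine MvPolynomial.funext fun c => ?_
  obtain ⟨r, hr⟩ := exists_coeff_prod_X_add_C_eq p
    fun i => if h : i < 3 * p then c ⟨i, h⟩ else 0
  obtain ⟨s, hs⟩ := exists_coeff_prod_X_add_C_eq (2 * p)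
    fun i => if h : p + i < 3 * p then c ⟨p + i, h⟩ else 0
  let θ : SiteRing K →ₐ[K] F := MvPolynomial.aeval fun v : ℕ × Fin 3 =>
    ![r v.1, s (2 * v.1), s (2 * v.1 + 1)] v.2
  have hθ : ∀ i, θ (siteGen K p i) = c i := by
    intro i
    have hi := i.2
    have hcoe : ∀ (q : (SiteRing K)[X]) (n : ℕ),
        θ (q.coeff n) = (q.map (θ : SiteRing K →+* F)).coeff n := fun q n => by simp
    rw [siteGen]
    split_ifs with h
    · rw [hcoe, ← (hr i h).trans (dif_pos hi)]
      simp [Polynomial.map_prod, θ]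
    · have := (hs (i - p) (by omega)).trans (dif_pos (by omega))
      simp only [show p + ((i : ℕ) - p) = i by omega] at this
      rw [hcoe, ← this, prod_range_two_mul]
      simp [Polynomial.map_prod, θ]
  have h0 := congrArg θ hP
  rw [map_zero, ← AlgHom.comp_apply, MvPolynomial.comp_aeval] at h0
  rw [MvPolynomial.eval_map, map_zero, ← MvPolynomial.aeval_def, ← h0]
  congr 2
  exact (funext hθ).symm

theorem IsDifferenceChain.exists_map_gamGen {K : Type} [Field K] {R : Type*} [Ring R]
    [Algebra K R] {ι : SiteRing K →+* R} {E : ℕ → Matrix (Fin 2) (Fin 2) R}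
    (h : IsDifferenceChain ι (fun n => MvPolynomial.X (n, 0)) (fun n => MvPolynomial.X (n, 1))
      (fun n => MvPolynomial.X (n, 2)) E) (p : ℕ) (i : Fin (3 * p)) :
    ∃ g : R[X], monodromyHom K p h.laurentTwist.toIsGl2Chain (gamGen K p i) = toLaurent g ∧
      constantCoeff g = ι (siteGen K p i) := by
  rw [gamGen, siteGen]
  split_ifs with hi
  · obtain ⟨P, Q, -, hQ, hQ0⟩ := h.exists_monodromy_laurentTwist p
    refine ⟨Q.coeff (p - (i + 1)), ?_, ?_⟩
    · rw [monodromyHom_tY _ _ _ (by omega) (by omega), hQ, coeff_map]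
    · rw [← coeff_map, hQ0, coeff_map]
  · refine ⟨C (ι _), ?_, coeff_C_zero⟩
    rw [dY, ← AlgHom.coe_toRingHom, ← coeff_map, map_monodromyHom_DY,
      h.laurentTwist.qdet_monodromy, coeff_map, toLaurent_C]
    rfl

/-- The `3p` elements `t_22^(1),…,t_22^(p), d_1,…,d_(2p)` are algebraically
independent over `k` in the level-`p` Yangian `Y_p(gl_2)`. -/
theorem gamGen_algebraically_independent (K : Type) [Field K] (p : ℕ)
    (P : MvPolynomial (Fin (3 * p)) K) (h : gamEval K p P = 0) : P = 0 := by
  choose g hg hg0 using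
    (siteGl2_isDifferenceChain K).exists_map_gamGen p
  have h1 : orderedEval (gamGen K p) P = 0 := h
  have h2 := (algHom_orderedEval (monodromyHom K p
    (siteGl2_isDifferenceChain K).laurentTwist.toIsGl2Chain) (gamGen K p) P).symm
  rw [h1, map_zero] at h2
  have h3 : toLaurent (orderedEval g P) = 0 := by
    rw [map_orderedEval _ fun c => ?_, ← h2]
    · congr 1
      exact funext fun i => (hg i).symm
    · exact toLaurent_C _
  have h4 : constantCoeff (orderedEval g P) = 0 := by rw [toLaurent_eq_zero.mp h3, map_zero]
  rw [map_orderedEval _ fun c => coeff_C_zero] at h4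
  have h5 : Algebra.lmul K (SiteRing K) (orderedEval (siteGen K p) P) = 0 := by
    rw [algHom_orderedEval, ← h4]
    congr 1
    exact funext fun i => (hg0 i).symm
  rw [map_eq_zero_iff _ Algebra.lmul_injective, orderedEval_eq_aeval] at h5
  exact algebraicIndependent_iff.mp (siteGen_algebraicIndependent K p) P h5
end
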